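/- Let T be a triangulated category. Suppose that the square with sides u₁ : X₁ → X₂, 0 : X₁ → 0, f₂ : X₂ → Y₂, 0 : 0 → Y₂ is homotopy cartesian, and that the square with sides ν₁ : X₂ → X₃, f₂ : X₂ → Y₂, f₃ : X₃ → Y₃, ν₂ : Y₂ → Y₃ (so f₃ ∘ ν₁ = ν₂ ∘ f₂) is homotopy cartesian. Then the square with sides ν₁ ∘ u₁ : X₁ → X₃, 0 : X₁ → 0, f₃ : X₃ → Y₃, 0 : 0 → Y₃ is homotopy cartesian; equivalently, there exists a morphism w : Y₃ → X₁[1] such that X₁ → X₃ → Y₃ → X₁[1], with first map ν₁ ∘ u₁ and second map f₃, is a distinguished triangle. -/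

import Mathlib

open CategoryTheory CategoryTheory.Limits CategoryTheory.Pretriangulated ZeroObject

variable {T : Type*} [Category T] [Preadditive T] [HasZeroObject T]
  [HasShift T ℤ] [∀ n : ℤ, (CategoryTheory.shiftFunctor T n).Additive]
  [Pretriangulated T]

/-- A commutative square `c ∘ a = d ∘ b` (with `a : A ⟶ C`, `b : A ⟶ B`, `c : C ⟶ D`,
`d : B ⟶ D`) is *homotopy cartesian* if there is `e : D ⟶ A⟦1⟧` such that
`A ⟶ B ⊞ C ⟶ D ⟶ A⟦1⟧` is a distinguished triangle, where the first map has components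
`b` and `a` and the second map has components `d` and `-c`. -/
def HomotopyCartesian {A B C D : T} (a : A ⟶ C) (b : A ⟶ B) (c : C ⟶ D) (d : B ⟶ D) : Prop :=
  ∃ e : D ⟶ A⟦(1 : ℤ)⟧,
    Triangle.mk (biprod.lift b a) (biprod.desc d (-c)) e ∈ distTriang T

/-- Distinguishedness of a triangle given by explicit morphisms is invariant under isomorphism. -/
lemma mk_distinguished_iff {X Y Z X' Y' Z' : T} {u : X ⟶ Y} {v : Y ⟶ Z} {w : Z ⟶ X⟦(1 : ℤ)⟧}
    {u' : X' ⟶ Y'} {v' : Y' ⟶ Z'} {w' : Z' ⟶ X'⟦(1 : ℤ)⟧} (e₁ : X ≅ X') (e₂ : Y ≅ Y')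
    (e₃ : Z ≅ Z') (hu : u ≫ e₂.hom = e₁.hom ≫ u') (hv : v ≫ e₃.hom = e₂.hom ≫ v')
    (hw : w ≫ e₁.hom⟦(1 : ℤ)⟧' = e₃.hom ≫ w') :
    Triangle.mk u v w ∈ distTriang T ↔ Triangle.mk u' v' w' ∈ distTriang T :=
  distinguished_iff_of_iso (Triangle.isoMk _ _ e₁ e₂ e₃ hu hv hw)

/-- Multiplication by `-1`, as an automorphism. -/
@[simps]
def negIso (X : T) : X ≅ X where
  hom := -𝟙 X
  inv := -𝟙 X

/-- The triangle `X ⊞ Y ⟶ X ⟶ Y⟦1⟧ ⟶ (X ⊞ Y)⟦1⟧` obtained by rotating the split triangle on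
`biprod.inr` and `biprod.fst` is distinguished. -/
lemma fst_zero_distinguished (X Y : T) :
    Triangle.mk (biprod.fst : X ⊞ Y ⟶ X) (0 : X ⟶ Y⟦(1 : ℤ)⟧)
      (-(biprod.inr : Y ⟶ X ⊞ Y)⟦(1 : ℤ)⟧') ∈ distTriang T := by
  refine rot_of_distTriang (Triangle.mk (biprod.inr : Y ⟶ X ⊞ Y) biprod.fst 0) ?_
  exact (mk_distinguished_iff (Iso.refl Y) (biprod.braiding X Y) (Iso.refl X)
    (by cat_disch) (by simp) (by simp)).2 (binaryBiproductTriangle_distinguished Y X)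

/-- A square with a zero corner is homotopy cartesian if and only if its nonzero sides are the
first two maps of a distinguished triangle. -/
lemma homotopyCartesian_zero_iff {X Y Z : T} (u : X ⟶ Y) (f : Y ⟶ Z) :
    HomotopyCartesian u (0 : X ⟶ 0) f (0 : (0 : T) ⟶ Z) ↔
      ∃ w : Z ⟶ X⟦(1 : ℤ)⟧, Triangle.mk u f w ∈ distTriang T := by
  let i : (0 : T) ⊞ Y ≅ Y :=
    { hom := biprod.snd
      inv := biprod.inr
      hom_inv_id := by
        apply biprod.hom_ext'
        · exact (isZero_zero T).eq_of_src _ _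
        · simp }
  have key : ∀ e : Z ⟶ X⟦(1 : ℤ)⟧,
      Triangle.mk (biprod.lift (0 : X ⟶ 0) u) (biprod.desc (0 : (0 : T) ⟶ Z) (-f)) e ∈
        distTriang T ↔ Triangle.mk u f (-e) ∈ distTriang T := fun e =>
    mk_distinguished_iff (Iso.refl X) i (negIso Z) (by simp [i])
      (by
        apply biprod.hom_ext'
        · exact (isZero_zero T).eq_of_src _ _
        · simp [i])
      (by simp)
  constructor
  · rintro ⟨e, he⟩
    exact ⟨-e, (key e).1 he⟩
  · rintro ⟨w, hw⟩
    exact ⟨-w, (key (-w)).2 (by rwa [neg_neg])⟩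

/-- A triangle is distinguished as soon as its double rotation, with the signs removed, is. -/
lemma distinguished_of_shift_distinguished {X Y Z : T} {u : X ⟶ Y} {f : Y ⟶ Z}
    {w : Z ⟶ X⟦(1 : ℤ)⟧} (h : Triangle.mk w (u⟦(1 : ℤ)⟧') (f⟦(1 : ℤ)⟧') ∈ distTriang T) :
    Triangle.mk u f w ∈ distTriang T := by
  rw [rotate_distinguished_triangle, rotate_distinguished_triangle]
  exact (mk_distinguished_iff (u := w) (v := -u⟦(1 : ℤ)⟧') (w := -f⟦(1 : ℤ)⟧')
    (Iso.refl _) (Iso.refl _) (negIso _) (by simp) (by simp) (by simp)).2 h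

/-- **Lemma (pullbacks of pullbacks).** If the square `(u₁ : X₁ ⟶ X₂, 0 : X₁ ⟶ 0,
f₂ : X₂ ⟶ Y₂, 0 : 0 ⟶ Y₂)` is homotopy cartesian and the square
`(ν₁ : X₂ ⟶ X₃, f₂ : X₂ ⟶ Y₂, f₃ : X₃ ⟶ Y₃, ν₂ : Y₂ ⟶ Y₃)` is homotopy cartesian,
then the square `(ν₁ ∘ u₁, 0, f₃, 0)` is homotopy cartesian; equivalently, there
exists `w : Y₃ ⟶ X₁⟦1⟧` such that `X₁ ⟶ X₃ ⟶ Y₃ ⟶ X₁⟦1⟧` (with maps `ν₁ ∘ u₁` and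
`f₃`) is a distinguished triangle. -/
theorem homotopyCartesian_comp_zero [IsTriangulated T]
    {X₁ X₂ X₃ Y₂ Y₃ : T}
    (u₁ : X₁ ⟶ X₂) (f₂ : X₂ ⟶ Y₂) (ν₁ : X₂ ⟶ X₃) (f₃ : X₃ ⟶ Y₃) (ν₂ : Y₂ ⟶ Y₃)
    (hcomm : ν₁ ≫ f₃ = f₂ ≫ ν₂)
    (h1 : HomotopyCartesian u₁ (0 : X₁ ⟶ 0) f₂ (0 : (0 : T) ⟶ Y₂))
    (h2 : HomotopyCartesian ν₁ f₂ f₃ ν₂) :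
    HomotopyCartesian (u₁ ≫ ν₁) (0 : X₁ ⟶ 0) f₃ (0 : (0 : T) ⟶ Y₃) ∧
      ∃ w : Y₃ ⟶ X₁⟦(1 : ℤ)⟧, Triangle.mk (u₁ ≫ ν₁) f₃ w ∈ distTriang T := by
  have htri : ∃ w : Y₃ ⟶ X₁⟦(1 : ℤ)⟧, Triangle.mk (u₁ ≫ ν₁) f₃ w ∈ distTriang T := by
    obtain ⟨w₁, hw₁⟩ := (homotopyCartesian_zero_iff u₁ f₂).1 h1
    obtain ⟨e, he⟩ := h2
    have hr : Triangle.mk f₂ w₁ (-u₁⟦(1 : ℤ)⟧') ∈ distTriang T := rot_of_distTriang _ hw₁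
    let O := Triangulated.someOctahedron (biprod.lift_fst f₂ ν₁) he
      (fst_zero_distinguished Y₂ X₃) hr
    have h₃ : O.m₃ = (u₁ ≫ ν₁)⟦(1 : ℤ)⟧' := by
      have h := O.comm₄ =≫ (biprod.snd : Y₂ ⊞ X₃ ⟶ X₃)⟦(1 : ℤ)⟧'
      simp only [Preadditive.neg_comp, Preadditive.comp_neg, Category.assoc,
        ← Functor.map_comp, biprod.lift_snd, biprod.inr_snd, neg_inj] at h
      rw [h, CategoryTheory.Functor.map_id, Category.comp_id]
    have h₄ : (-(biprod.inr : X₃ ⟶ Y₂ ⊞ X₃)⟦(1 : ℤ)⟧') ≫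
        (biprod.desc ν₂ (-f₃))⟦(1 : ℤ)⟧' = f₃⟦(1 : ℤ)⟧' := by
      rw [Preadditive.neg_comp, ← Functor.map_comp, biprod.inr_desc, Functor.map_neg, neg_neg]
    refine ⟨O.m₁, distinguished_of_shift_distinguished ?_⟩
    rw [← h₃, ← h₄]
    exact O.mem
  exact ⟨(homotopyCartesian_zero_iff _ _).2 htri, htri⟩
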